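/- Let P be a convex lattice polygon in R^2 with at least 5 vertices such that one of its edges has lattice length 4 (i.e., contains exactly 5 lattice points). Then the normalized volume of P (twice its Euclidean area) is at least 9. -/

import Mathlib

/-- Embedding of lattice points of `ℤ²` into the real plane. -/
def toR (p : ℤ × ℤ) : ℝ × ℝ := ((p.1 : ℝ), (p.2 : ℝ))

open MeasureTheory

/-- The planar cross product (determinant) of two vectors. -/
def cross (u v : ℝ × ℝ) : ℝ := u.1 * v.2 - u.2 * v.1

theorem volume_open_standard_triangle :
    volume (regionBetween (fun _ : ℝ => (0 : ℝ)) (fun x => 1 - x) (Set.Ioo 0 1)) =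
      ENNReal.ofReal (1 / 2) := by
  rw [Measure.volume_eq_prod, volume_regionBetween_eq_integral]
  · congr 1
    rw [← integral_Ioc_eq_integral_Ioo, ← intervalIntegral.integral_of_le zero_le_one]
    simp only [Pi.sub_apply, sub_zero]
    rw [intervalIntegral.integral_sub (by simp) (by simp)]
    norm_num
  · exact (integrableOn_const (by simp))
  · exact ((by fun_prop : Continuous fun x : ℝ => 1 - x).integrableOn_Icc).mono_set
      Set.Ioo_subset_Icc_self
  · exact measurableSet_Ioo
  · intro x hx
    simpa using hx.2.le

/-- The open triangle with vertices `p`, `q`, `r`. -/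
def openTriangle (p q r : ℝ × ℝ) : Set (ℝ × ℝ) :=
  {z | ∃ s t : ℝ, 0 < s ∧ 0 < t ∧ s + t < 1 ∧ z = p + (s • (q - p) + t • (r - p))}

theorem volume_openTriangle (p q r : ℝ × ℝ) :
    volume (openTriangle p q r) = ENNReal.ofReal (|cross (q - p) (r - p)| / 2) := by
  set M : Matrix (Fin 2) (Fin 2) ℝ := !![(q - p).1, (r - p).1; (q - p).2, (r - p).2] with hM
  set L := Matrix.toLin (Module.Basis.finTwoProd ℝ) (Module.Basis.finTwoProd ℝ) M with hL
  have himage : openTriangle p q r = (fun z => p + z) ''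
      (L '' regionBetween (fun _ : ℝ => (0 : ℝ)) (fun x => 1 - x) (Set.Ioo 0 1)) := by
    ext z
    simp only [openTriangle, Set.mem_ofPred_eq, Set.mem_image, regionBetween, exists_exists_and_eq_and]
    constructor
    · rintro ⟨s, t, hs, ht, hst, rfl⟩
      refine ⟨(s, t), ⟨⟨hs, by linarith⟩, ht, by simp only; linarith⟩, ?_⟩
      rw [hL, hM, Matrix.toLin_finTwoProd_apply]
      ext <;> simp <;> ring
    · rintro ⟨⟨s, t⟩, ⟨⟨hs, -⟩, ht, hst⟩, rfl⟩
      refine ⟨s, t, hs, ht, by simp only at hst; linarith, ?_⟩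
      rw [hL, hM, Matrix.toLin_finTwoProd_apply]
      ext <;> simp <;> ring
  rw [himage, Set.image_add_left, measure_preimage_add, Measure.addHaar_image_linearMap,
    volume_open_standard_triangle, hL, LinearMap.det_toLin, ← ENNReal.ofReal_mul (abs_nonneg _)]
  congr 1
  rw [hM, Matrix.det_fin_two_of, cross, mul_comm (r - p).1]
  ring

theorem openTriangle_subset {P : Set (ℝ × ℝ)} (hP : Convex ℝ P) {p q r : ℝ × ℝ}
    (hp : p ∈ P) (hq : q ∈ P) (hr : r ∈ P) : openTriangle p q r ⊆ P := by
  rintro z ⟨s, t, hs, ht, hst, rfl⟩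
  have := hP.sum_mem (t := Finset.univ) (w := ![1 - s - t, s, t]) (z := ![p, q, r])
    (by intro i _; fin_cases i <;> simp <;> linarith)
    (by simp [Fin.sum_univ_three]; ring)
    (by intro i _; fin_cases i <;> simpa)
  convert this using 1
  simp only [Fin.sum_univ_three, Matrix.cons_val_zero, Matrix.cons_val_one, Matrix.cons_val]
  module

theorem cross_of_mem_openTriangle {p q r z : ℝ × ℝ} (hz : z ∈ openTriangle p q r) :
    ∃ t : ℝ, 0 < t ∧ cross (q - p) (z - p) = t * cross (q - p) (r - p) := by
  obtain ⟨s, t, hs, ht, hst, rfl⟩ := hz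
  refine ⟨t, ht, ?_⟩
  simp [cross]
  ring

/-- Two triangles on opposite sides of a common edge contribute both their areas. -/
theorem add_cross_le_two_mul_volume {P : Set (ℝ × ℝ)} (hP : Convex ℝ P)
    (hfin : volume P ≠ ⊤) {p q r s : ℝ × ℝ} (hp : p ∈ P) (hq : q ∈ P) (hr : r ∈ P) (hs : s ∈ P)
    (hpos : 0 < cross (q - p) (r - p)) (hneg : cross (q - p) (s - p) < 0) :
    cross (q - p) (r - p) - cross (q - p) (s - p) ≤ 2 * (volume P).toReal := by
  set H : Set (ℝ × ℝ) := {z | 0 < cross (q - p) (z - p)} with hH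
  have hmeas : MeasurableSet H := by
    refine (isOpen_lt continuous_const ?_).measurableSet
    unfold cross
    fun_prop
  have h₁ : openTriangle p q r ⊆ P ∩ H := fun z hz => by
    refine ⟨openTriangle_subset hP hp hq hr hz, ?_⟩
    obtain ⟨t, ht, h⟩ := cross_of_mem_openTriangle hz
    exact (mul_pos ht hpos).trans_eq h.symm
  have h₂ : openTriangle p q s ⊆ P \ H := fun z hz => by
    refine ⟨openTriangle_subset hP hp hq hs hz, ?_⟩
    obtain ⟨t, ht, h⟩ := cross_of_mem_openTriangle hz
    simp only [hH, Set.mem_ofPred_eq, h, not_lt]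
    exact (mul_neg_of_pos_of_neg ht hneg).le
  have hle := add_le_add (measure_mono (μ := volume) h₁) (measure_mono (μ := volume) h₂)
  rw [measure_inter_add_sdiff _ hmeas, volume_openTriangle, volume_openTriangle,
    ← ENNReal.ofReal_add (by positivity) (by positivity),
    ENNReal.ofReal_le_iff_le_toReal hfin, abs_of_pos hpos, abs_of_neg hneg] at hle
  linarith

theorem mem_convexHull_triangle {a b c d : ℝ × ℝ} (hpos : 0 < cross (b - a) (c - a))
    (hab : 0 ≤ cross (b - a) (d - a)) (hbc : 0 ≤ cross (c - b) (d - b))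
    (hca : 0 ≤ cross (a - c) (d - c)) : d ∈ convexHull ℝ {a, b, c} := by
  set k := cross (b - a) (c - a) with hk
  have hsum : cross (c - b) (d - b) / k + cross (a - c) (d - c) / k
      + cross (b - a) (d - a) / k = 1 := by
    rw [← add_div, ← add_div, div_eq_one_iff_eq hpos.ne', hk]
    simp only [cross, Prod.fst_sub, Prod.snd_sub]
    ring
  have := (convex_convexHull ℝ {a, b, c}).sum_mem (t := Finset.univ)
    (w := ![cross (c - b) (d - b) / k, cross (a - c) (d - c) / k, cross (b - a) (d - a) / k])
    (z := ![a, b, c])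
    (by intro i _; fin_cases i <;> simp <;> positivity)
    (by simpa [Fin.sum_univ_three] using hsum)
    (by intro i _; apply subset_convexHull; fin_cases i <;> simp)
  convert this using 1
  simp only [Fin.sum_univ_three, Matrix.cons_val_zero, Matrix.cons_val_one, Matrix.cons_val]
  ext
  · simp only [Prod.fst_add, Prod.smul_fst, smul_eq_mul]
    field_simp
    simp only [hk, cross, Prod.fst_sub, Prod.snd_sub]
    ring
  · simp only [Prod.snd_add, Prod.smul_snd, smul_eq_mul]
    field_simp
    simp only [hk, cross, Prod.fst_sub, Prod.snd_sub]
    ring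

theorem mem_of_mem_convexHull_of_mem_extremePoints {P T : Set (ℝ × ℝ)} (hP : Convex ℝ P)
    {x : ℝ × ℝ} (hx : x ∈ Set.extremePoints ℝ P) (hT : T ⊆ P) (hxT : x ∈ convexHull ℝ T) :
    x ∈ T :=
  extremePoints_convexHull_subset
    (inter_extremePoints_subset_extremePoints_of_subset (convexHull_min hT hP) ⟨hxT, hx⟩)

/-- Three extreme points of a convex set on a common line cannot be pairwise distinct. -/
theorem not_three_extremePoints_on_line {P : Set (ℝ × ℝ)} (hP : Convex ℝ P)
    {p q r w : ℝ × ℝ} (hp : p ∈ Set.extremePoints ℝ P) (hq : q ∈ Set.extremePoints ℝ P)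
    (hr : r ∈ Set.extremePoints ℝ P) (hw : w ≠ 0) (hpq : p ≠ q) (hpr : p ≠ r) (hqr : q ≠ r)
    (h₁ : cross w (q - p) = 0) (h₂ : cross w (r - p) = 0) : False := by
  have hpar : ∀ v : ℝ × ℝ, cross w v = 0 → ∃ t : ℝ, v = t • w := by
    intro v hv
    unfold cross at hv
    by_cases h : w.1 = 0
    · have h2 : w.2 ≠ 0 := fun h2 => hw (Prod.ext h h2)
      refine ⟨v.2 / w.2, Prod.ext ?_ ?_⟩
      · have : v.1 = 0 := by simpa [h, h2] using hv
        simp [h, this]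
      · simp [h2]
    · refine ⟨v.1 / w.1, Prod.ext ?_ ?_⟩
      · simp [h]
      · simp
        field_simp
        linarith
  have hcol : Collinear ℝ {p, q, r} := by
    rw [collinear_iff_of_mem (p₀ := p) (by simp)]
    refine ⟨w, ?_⟩
    rintro x (rfl | rfl | rfl)
    · exact ⟨0, by simp⟩
    · obtain ⟨t, ht⟩ := hpar _ h₁
      exact ⟨t, by rw [← ht]; simp⟩
    · obtain ⟨t, ht⟩ := hpar _ h₂
      exact ⟨t, by rw [← ht]; simp⟩
  have hbetween : ∀ {x y z : ℝ × ℝ}, x ∈ Set.extremePoints ℝ P → y ∈ Set.extremePoints ℝ P →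
      z ∈ Set.extremePoints ℝ P → Wbtw ℝ x y z → y = x ∨ y = z := by
    intro x y z hx hy hz h
    rw [← mem_segment_iff_wbtw, ← convexHull_pair] at h
    simpa using mem_of_mem_convexHull_of_mem_extremePoints hP hy
      (Set.pair_subset hx.1 hz.1) h
  rcases hcol.wbtw_or_wbtw_or_wbtw with h | h | h
  · rcases hbetween hp hq hr h with h | h
    exacts [hpq h.symm, hqr h]
  · rcases hbetween hq hr hp h with h | h
    exacts [hqr h.symm, hpr h.symm]
  · rcases hbetween hr hp hq h with h | h
    exacts [hpr h, hpq h]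

theorem exists_int_cross (p q r s : ℤ × ℤ) :
    ∃ n : ℤ, cross (toR q - toR p) (toR s - toR r) = n :=
  ⟨(q.1 - p.1) * (s.2 - r.2) - (q.2 - p.2) * (s.1 - r.1), by simp [cross, toR]⟩

/-- A lattice quadrilateral cut out by adding a vertex outside a triangle of normalized
volume at least `8` has normalized volume at least `9`. -/
theorem nine_le_of_triangle {P : Set (ℝ × ℝ)} (hP : Convex ℝ P) (hfin : volume P ≠ ⊤)
    {A B C D : ℤ × ℤ} (hA : toR A ∈ P) (hB : toR B ∈ P) (hC : toR C ∈ P) (hD : toR D ∈ P)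
    (hABC : 8 ≤ cross (toR B - toR A) (toR C - toR A))
    (hABD : 0 ≤ cross (toR B - toR A) (toR D - toR A))
    (hout : toR D ∉ convexHull ℝ {toR A, toR B, toR C}) :
    9 ≤ 2 * (volume P).toReal := by
  have hrot₁ : cross (toR C - toR B) (toR A - toR B) = cross (toR B - toR A) (toR C - toR A) := by
    simp only [cross, Prod.fst_sub, Prod.snd_sub]; ring
  have hrot₂ : cross (toR A - toR C) (toR B - toR C) = cross (toR B - toR A) (toR C - toR A) := by
    simp only [cross, Prod.fst_sub, Prod.snd_sub]; ring
  have hint : ∀ X Y : ℤ × ℤ, cross (toR Y - toR X) (toR D - toR X) < 0 →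
      cross (toR Y - toR X) (toR D - toR X) ≤ -1 := by
    intro X Y h
    obtain ⟨n, hn⟩ := exists_int_cross X Y X D
    rw [hn] at h ⊢
    have : n < 0 := by exact_mod_cast h
    exact_mod_cast (by omega : n ≤ -1)
  by_cases hBC : cross (toR C - toR B) (toR D - toR B) < 0
  · have := add_cross_le_two_mul_volume hP hfin hB hC hA hD (by linarith) hBC
    linarith [hint _ _ hBC]
  by_cases hCA : cross (toR A - toR C) (toR D - toR C) < 0
  · have := add_cross_le_two_mul_volume hP hfin hC hA hB hD (by linarith) hCA
    linarith [hint _ _ hCA]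
  exact absurd (mem_convexHull_triangle (by linarith) hABD (not_lt.1 hBC) (not_lt.1 hCA)) hout

/-- A convex body lies on one side of the line through a boundary segment. -/
theorem one_side_of_segment_subset_frontier {P : Set (ℝ × ℝ)} (hP : Convex ℝ P)
    (hdim : (interior P).Nonempty) {a b : ℝ × ℝ} (ha : a ∈ P) (hb : b ∈ P) (hab : a ≠ b)
    (hedge : segment ℝ a b ⊆ frontier P) :
    (∀ x ∈ P, 0 ≤ cross (b - a) (x - a)) ∨ (∀ x ∈ P, cross (b - a) (x - a) ≤ 0) := by
  have hm := hedge (midpoint_mem_segment (𝕜 := ℝ) a b)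
  obtain ⟨f, hf⟩ := geometric_hahn_banach_open_point hP.interior isOpen_interior hm.2
  have hfle : ∀ x ∈ P, f x ≤ f (midpoint ℝ a b) := by
    intro x hx
    have hcl : closure (interior P) ⊆ {y | f y ≤ f (midpoint ℝ a b)} :=
      closure_minimal (fun y hy => (hf y hy).le) (isClosed_le f.continuous continuous_const)
    apply hcl
    rw [hP.closure_interior_eq_closure_of_nonempty_interior hdim]
    exact subset_closure hx
  have hmid : f (midpoint ℝ a b) = (f a + f b) / 2 := by
    rw [midpoint_eq_smul_add, map_smul, map_add, smul_eq_mul, invOf_eq_inv]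
    ring
  have hfa : f a = f b := by linarith [hfle a ha, hfle b hb]
  have hfx : ∀ x : ℝ × ℝ, f x = x.1 * f (1, 0) + x.2 * f (0, 1) := by
    intro x
    rw [← smul_eq_mul, ← smul_eq_mul, ← map_smul, ← map_smul, ← map_add]
    congr 1
    ext <;> simp
  set α := f (1, 0)
  set β := f (0, 1)
  have hd : (b - a).1 * α + (b - a).2 * β = 0 := by
    rw [← hfx, map_sub, hfa, sub_self]
  obtain ⟨c, hcα, hcβ⟩ : ∃ c : ℝ, α = -c * (b - a).2 ∧ β = c * (b - a).1 := by
    by_cases h1 : (b - a).1 = 0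
    · have h2 : (b - a).2 ≠ 0 := fun h2 => hab (sub_eq_zero.1 (Prod.ext h1 h2)).symm
      refine ⟨-α / (b - a).2, ?_, ?_⟩
      · field_simp
      · rw [h1, zero_mul, zero_add] at hd
        rw [h1, mul_zero, (mul_eq_zero.1 hd).resolve_left h2]
    · refine ⟨β / (b - a).1, ?_, ?_⟩
      · field_simp
        linarith
      · field_simp
  have hside : ∀ x ∈ P, c * cross (b - a) (x - a) ≤ 0 := by
    intro x hx
    have h : f (x - a) = c * cross (b - a) (x - a) := by
      rw [hfx, hcα, hcβ, cross]; ring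
    rw [← h, map_sub]
    linarith [hfle x hx]
  have hc : c ≠ 0 := by
    rintro rfl
    obtain ⟨y, hy⟩ := hdim
    have := hf y hy
    rw [hfx, hfx (midpoint ℝ a b), hcα, hcβ] at this
    simp at this
  rcases lt_or_gt_of_ne hc with hc | hc
  · exact Or.inl fun x hx => by nlinarith [hside x hx]
  · exact Or.inr fun x hx => by nlinarith [hside x hx]

/-- A lattice segment with at least `n + 1` lattice points is an integer multiple, by a factor
at least `n`, of a lattice vector. -/
theorem exists_direction_of_ncard_segment {A B : ℤ × ℤ} (hAB : A ≠ B) {n : ℕ}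
    (hn : n + 1 ≤ {m : ℤ × ℤ | toR m ∈ segment ℝ (toR A) (toR B)}.ncard) :
    ∃ (g : ℤ) (w : ℤ × ℤ), n ≤ g ∧ B = A + g • w := by
  set d := B - A with hd
  have hgcd : 0 < Int.gcd d.1 d.2 := by
    refine Nat.pos_of_ne_zero fun h => hAB ?_
    rw [Int.gcd_eq_zero_iff] at h
    exact (sub_eq_zero.1 (Prod.ext h.1 h.2 : d = 0)).symm
  obtain ⟨u, v, huv, hu, hv⟩ := Int.exists_gcd_one hgcd
  set g := Int.gcd d.1 d.2
  refine ⟨g, (u, v), ?_, ?_⟩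
  · have hsub : {m : ℤ × ℤ | toR m ∈ segment ℝ (toR A) (toR B)} ⊆
        ((Finset.range (g + 1)).image fun k : ℕ => A + (k : ℤ) • (u, v) : Finset (ℤ × ℤ)) := by
      intro m hm
      rw [Set.mem_ofPred_eq, segment_eq_image'] at hm
      obtain ⟨t, ⟨ht0, ht1⟩, htm⟩ := hm
      have hg : (0 : ℝ) < g := by exact_mod_cast hgcd
      have hBA1 : (B.1 : ℝ) - A.1 = u * g := by exact_mod_cast hu
      have hBA2 : (B.2 : ℝ) - A.2 = v * g := by exact_mod_cast hv
      have hm1 : (m.1 : ℝ) - A.1 = t * g * u := by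
        have := congrArg Prod.fst htm
        simp only [toR, Prod.fst_add, Prod.smul_fst, Prod.fst_sub, smul_eq_mul, hBA1] at this
        linarith
      have hm2 : (m.2 : ℝ) - A.2 = t * g * v := by
        have := congrArg Prod.snd htm
        simp only [toR, Prod.snd_add, Prod.smul_snd, Prod.snd_sub, smul_eq_mul, hBA2] at this
        linarith
      obtain ⟨x, y, hxy⟩ := Int.isCoprime_iff_gcd_eq_one.2 huv
      have hxyR : (x : ℝ) * u + y * v = 1 := by exact_mod_cast hxy
      set k : ℤ := x * (m.1 - A.1) + y * (m.2 - A.2) with hk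
      have hkR : (k : ℝ) = t * g := by
        rw [hk]; push_cast
        rw [hm1, hm2]
        linear_combination t * g * hxyR
      have hk0 : 0 ≤ k := by
        have : (0 : ℝ) ≤ k := by rw [hkR]; positivity
        exact_mod_cast this
      have hkg : k ≤ g := by
        have : (k : ℝ) ≤ g := by rw [hkR]; nlinarith
        exact_mod_cast this
      have e1 : m.1 - A.1 = k * u := by
        rw [← hkR] at hm1; exact_mod_cast hm1
      have e2 : m.2 - A.2 = k * v := by
        rw [← hkR] at hm2; exact_mod_cast hm2
      rw [Finset.mem_coe, Finset.mem_image]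
      refine ⟨k.toNat, by rw [Finset.mem_range]; omega, ?_⟩
      rw [Int.toNat_of_nonneg hk0]
      ext
      · simp; linarith
      · simp; linarith
    have h₁ := Set.ncard_le_ncard hsub (Finset.finite_toSet _)
    rw [Set.ncard_coe_finset] at h₁
    have h₂ := (h₁.trans Finset.card_image_le)
    rw [Finset.card_range] at h₂
    omega
  · ext
    · simp only [Prod.fst_add, Prod.smul_fst, smul_eq_mul]
      have : B.1 - A.1 = u * g := hu
      linarith
    · simp only [Prod.snd_add, Prod.smul_snd, smul_eq_mul]
      have : B.2 - A.2 = v * g := hv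
      linarith

theorem nine_le_of_nonneg_side (S : Finset (ℤ × ℤ)) (P : Set (ℝ × ℝ))
    (hP : P = convexHull ℝ (toR '' (S : Set (ℤ × ℤ))))
    (hvert : 5 ≤ (Set.extremePoints ℝ P).ncard) (A B : ℤ × ℤ) (hAB : A ≠ B)
    (ha : toR A ∈ Set.extremePoints ℝ P) (hb : toR B ∈ Set.extremePoints ℝ P)
    (hside : ∀ x ∈ P, 0 ≤ cross (toR B - toR A) (x - toR A))
    (hlen : {m : ℤ × ℤ | toR m ∈ segment ℝ (toR A) (toR B)}.ncard = 5) :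
    9 ≤ 2 * (volume P).toReal := by
  have hconv : Convex ℝ P := hP ▸ convex_convexHull ℝ _
  have hfinS : (toR '' (S : Set (ℤ × ℤ))).Finite := S.finite_toSet.image _
  have hvol : volume P ≠ ⊤ := by
    rw [hP]
    exact (hfinS.isCompact_convexHull ℝ).measure_lt_top.ne
  have hext : Set.extremePoints ℝ P ⊆ toR '' (S : Set (ℤ × ℤ)) := by
    rw [hP]; exact extremePoints_convexHull_subset (𝕜 := ℝ)
  have hlattice : ∀ x ∈ Set.extremePoints ℝ P, ∃ X, toR X = x := fun x hx =>
    let ⟨X, _, hX⟩ := hext hx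
    ⟨X, hX⟩
  obtain ⟨g, w, hg, hB⟩ := exists_direction_of_ncard_segment (n := 4) hAB hlen.ge
  have hgR : (4 : ℝ) ≤ g := by exact_mod_cast hg
  have hw : toR w ≠ 0 := by
    intro h
    have h1 : w.1 = 0 := by simpa [toR] using congrArg Prod.fst h
    have h2 : w.2 = 0 := by simpa [toR] using congrArg Prod.snd h
    exact hAB (by rw [hB, (Prod.ext h1 h2 : w = 0)]; simp)
  have hcross : ∀ x, cross (toR B - toR A) x = g * cross (toR w) x := by
    intro x
    rw [hB]
    simp [cross, toR]
    ring
  have hfar : ∀ x ∈ Set.extremePoints ℝ P, toR A ≠ x → toR B ≠ x →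
      ∃ k : ℤ, 1 ≤ k ∧ cross (toR w) (x - toR A) = k := by
    intro x hx hxA hxB
    obtain ⟨X, rfl⟩ := hlattice x hx
    obtain ⟨k, hk⟩ := exists_int_cross 0 w A X
    have h0 : toR 0 = 0 := by simp [toR]
    rw [h0, sub_zero] at hk
    refine ⟨k, ?_, hk⟩
    have hnonneg := hside _ hx.1
    rw [hcross, hk] at hnonneg
    have hk0 : (0 : ℝ) ≤ k := nonneg_of_mul_nonneg_right hnonneg (by linarith)
    have hk0' : 0 ≤ k := by exact_mod_cast hk0
    have hne : k ≠ 0 := by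
      rintro rfl
      refine not_three_extremePoints_on_line hconv ha hb hx hw (fun h => hw ?_) hxA hxB ?_ ?_
      · have h1 : (A.1 : ℝ) = B.1 := congrArg Prod.fst h
        have h2 : (A.2 : ℝ) = B.2 := congrArg Prod.snd h
        exact absurd (Prod.ext (by exact_mod_cast h1) (by exact_mod_cast h2)) hAB
      · rw [hB]
        simp [cross, toR]
        ring
      · simpa using hk
    omega
  have htwo : ∀ x ∈ Set.extremePoints ℝ P, ∀ y ∈ Set.extremePoints ℝ P,
      toR A ≠ x → toR B ≠ x → toR A ≠ y → toR B ≠ y → x ≠ y →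
      2 ≤ cross (toR w) (x - toR A) → 9 ≤ 2 * (volume P).toReal := by
    intro x hx y hy hxA hxB hyA hyB hxy h2
    obtain ⟨X, rfl⟩ := hlattice x hx
    obtain ⟨Y, rfl⟩ := hlattice y hy
    refine nine_le_of_triangle hconv hvol ha.1 hb.1 hx.1 hy.1 ?_ (hside _ hy.1) fun h => ?_
    · rw [hcross]; nlinarith
    · have hsub : ({toR A, toR B, toR X} : Set (ℝ × ℝ)) ⊆ P := by
        rintro z (rfl | rfl | rfl)
        exacts [ha.1, hb.1, hx.1]
      rcases mem_of_mem_convexHull_of_mem_extremePoints hconv hy hsub h with h | h | h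
      exacts [hyA h.symm, hyB h.symm, hxy h.symm]
  have hfinE : (Set.extremePoints ℝ P).Finite := hfinS.subset hext
  have hcard : 2 < (Set.extremePoints ℝ P \ {toR A, toR B}).ncard := by
    have h₁ := Set.le_ncard_sdiff {toR A, toR B} (Set.extremePoints ℝ P)
    have h₂ := Set.ncard_insert_le (toR A) {toR B}
    rw [Set.ncard_singleton] at h₂
    omega
  rw [Set.two_lt_ncard_iff (hfinE.subset Set.sdiff_subset)] at hcard
  obtain ⟨x, y, z, ⟨hx, hx'⟩, ⟨hy, hy'⟩, ⟨hz, hz'⟩, hxy, hxz, hyz⟩ := hcard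
  simp only [Set.mem_insert_iff, Set.mem_singleton_iff, not_or] at hx' hy' hz'
  obtain ⟨i, hi, hxi⟩ := hfar x hx (Ne.symm hx'.1) (Ne.symm hx'.2)
  obtain ⟨j, hj, hyj⟩ := hfar y hy (Ne.symm hy'.1) (Ne.symm hy'.2)
  obtain ⟨k, hk, hzk⟩ := hfar z hz (Ne.symm hz'.1) (Ne.symm hz'.2)
  by_cases hi2 : 2 ≤ i
  · exact htwo x hx y hy (Ne.symm hx'.1) (Ne.symm hx'.2) (Ne.symm hy'.1) (Ne.symm hy'.2) hxy
      (by rw [hxi]; exact_mod_cast hi2)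
  by_cases hj2 : 2 ≤ j
  · exact htwo y hy x hx (Ne.symm hy'.1) (Ne.symm hy'.2) (Ne.symm hx'.1) (Ne.symm hx'.2)
      hxy.symm (by rw [hyj]; exact_mod_cast hj2)
  by_cases hk2 : 2 ≤ k
  · exact htwo z hz x hx (Ne.symm hz'.1) (Ne.symm hz'.2) (Ne.symm hx'.1) (Ne.symm hx'.2)
      hxz.symm (by rw [hzk]; exact_mod_cast hk2)
  obtain rfl : i = 1 := by omega
  obtain rfl : j = 1 := by omega
  obtain rfl : k = 1 := by omega
  refine (not_three_extremePoints_on_line hconv hx hy hz hw hxy hxz hyz ?_ ?_).elim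
  · simp only [cross, Prod.fst_sub, Prod.snd_sub] at hxi hyj ⊢
    linarith
  · simp only [cross, Prod.fst_sub, Prod.snd_sub] at hxi hzk ⊢
    linarith

/-- A convex lattice polygon with at least 5 vertices, one of whose edges has lattice
length 4 (contains exactly 5 lattice points), has normalized volume (twice the
Euclidean area) at least 9. -/
theorem stmt4 (S : Finset (ℤ × ℤ)) (P : Set (ℝ × ℝ))
    (hP : P = convexHull ℝ (toR '' (S : Set (ℤ × ℤ))))
    (hdim : (interior P).Nonempty)
    (hvert : 5 ≤ (Set.extremePoints ℝ P).ncard)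
    (a b : ℝ × ℝ) (ha : a ∈ Set.extremePoints ℝ P) (hb : b ∈ Set.extremePoints ℝ P)
    (hedge : segment ℝ a b ⊆ frontier P)
    (hlen : {m : ℤ × ℤ | toR m ∈ segment ℝ a b}.ncard = 5) :
    9 ≤ 2 * (MeasureTheory.volume P).toReal := by
  have hext : Set.extremePoints ℝ P ⊆ toR '' (S : Set (ℤ × ℤ)) := by
    rw [hP]; exact extremePoints_convexHull_subset (𝕜 := ℝ)
  obtain ⟨A, -, rfl⟩ := hext ha
  obtain ⟨B, -, rfl⟩ := hext hb
  have hinj : Function.Injective toR := fun p q h => by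
    have h1 : (p.1 : ℝ) = q.1 := congrArg Prod.fst h
    have h2 : (p.2 : ℝ) = q.2 := congrArg Prod.snd h
    exact Prod.ext (by exact_mod_cast h1) (by exact_mod_cast h2)
  have hAB : A ≠ B := by
    rintro rfl
    have : {m : ℤ × ℤ | toR m ∈ segment ℝ (toR A) (toR A)} = {A} := by
      ext m
      simp [hinj.eq_iff]
    rw [this, Set.ncard_singleton] at hlen
    omega
  have hconv : Convex ℝ P := hP ▸ convex_convexHull ℝ _
  rcases one_side_of_segment_subset_frontier hconv hdim ha.1 hb.1 (hinj.ne hAB) hedge with h | h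
  · exact nine_le_of_nonneg_side S P hP hvert A B hAB ha hb h hlen
  · refine nine_le_of_nonneg_side S P hP hvert B A hAB.symm hb ha (fun x hx => ?_)
      (by rwa [segment_symm])
    have := h x hx
    simp only [cross, Prod.fst_sub, Prod.snd_sub] at this ⊢
    linarith
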